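/- arXiv:2402.10456 — 2 statements merged into one kernel-verified Lean document; each statement's English description precedes it below -/
import Mathlib

section
/- Let P_X be a Borel probability measure on ℝ^d whose support is contained in B_M for some M > 0, and let λ₁,…,λ_d ≥ 0. For x^(1),…,x^(n) ∈ B_M define H(x^(1),…,x^(n)) := sup_{φ∈F_λ} { ∫ φ dP_X − n⁻¹ Σ_{i=1}^n φ(x^(i)) }. Then H takes finite values on (B_M)^n, and for any i ∈ {1,…,n} and any x^(1),…,x^(n), y^(i) ∈ B_M, |H(x^(1),…,x^(i),…,x^(n)) − H(x^(1),…,y^(i),…,x^(n))| ≤ n⁻¹ (1 + ‖λ‖₂) ‖x^(i) − y^(i)‖₂ ≤ 2(1 + ‖λ‖₂)M/n, where ‖λ‖₂ = (Σ_{j=1}^d λ_j²)^{1/2}. -/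
open MeasureTheory Set
open scoped ENNReal

/-- The function class `F_λ`: functions of the form `f + ∑ j, λ j * (f_j ∘ p_j)`
with `f` 1-Lipschitz on `ℝ^d` and each `f_j` 1-Lipschitz on `ℝ`. -/
def Flam {d : ℕ} (lam : Fin d → ℝ) : Set (EuclideanSpace ℝ (Fin d) → ℝ) :=
  {φ | ∃ (f : EuclideanSpace ℝ (Fin d) → ℝ) (g : Fin d → ℝ → ℝ),
    LipschitzWith 1 f ∧ (∀ j, LipschitzWith 1 (g j)) ∧
    ∀ x, φ x = f x + ∑ j : Fin d, lam j * g j (x j)}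

/-- The supremum `H(x⁽¹⁾, …, x⁽ⁿ⁾) = sup_{φ ∈ F_λ} (∫ φ dP_X - n⁻¹ ∑ᵢ φ(x⁽ⁱ⁾))`. -/
noncomputable def Hfun {d n : ℕ} (lam : Fin d → ℝ)
    (P : Measure (EuclideanSpace ℝ (Fin d)))
    (x : Fin n → EuclideanSpace ℝ (Fin d)) : ℝ :=
  sSup {r : ℝ | ∃ φ ∈ Flam lam,
    r = (∫ y, φ y ∂P) - (n : ℝ)⁻¹ * ∑ i : Fin n, φ (x i)}

section

variable {d n : ℕ} {lam : Fin d → ℝ} {φ : EuclideanSpace ℝ (Fin d) → ℝ}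

theorem abs_sub_le_of_mem_Flam (hφ : φ ∈ Flam lam) (x y : EuclideanSpace ℝ (Fin d)) :
    |φ x - φ y| ≤ (1 + Real.sqrt (∑ j : Fin d, lam j ^ 2)) * ‖x - y‖ := by
  obtain ⟨f, g, hf, hg, hφ⟩ := hφ
  have hfxy : |f x - f y| ≤ ‖x - y‖ := by
    simpa [Real.dist_eq, dist_eq_norm] using hf.dist_le_mul x y
  have hgxy : |∑ j, lam j * (g j (x j) - g j (y j))| ≤
      Real.sqrt (∑ j : Fin d, lam j ^ 2) * ‖x - y‖ := by
    calc |∑ j, lam j * (g j (x j) - g j (y j))|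
        ≤ ∑ j, |lam j| * |(x - y) j| := by
          refine (Finset.abs_sum_le_sum_abs _ _).trans (Finset.sum_le_sum fun j _ => ?_)
          rw [abs_mul]
          refine mul_le_mul_of_nonneg_left ?_ (abs_nonneg _)
          simpa [Real.dist_eq] using (hg j).dist_le_mul (x j) (y j)
      _ ≤ _ := by
          have h := Real.sum_mul_le_sqrt_mul_sqrt Finset.univ
            (fun j => |lam j|) (fun j => |(x - y) j|)
          simpa only [EuclideanSpace.norm_eq, Real.norm_eq_abs, sq_abs] using h
  have hsplit : φ x - φ y = (f x - f y) + ∑ j, lam j * (g j (x j) - g j (y j)) := by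
    simp only [hφ, mul_sub, Finset.sum_sub_distrib]
    ring
  rw [hsplit, add_mul, one_mul]
  exact (abs_add_le _ _).trans (add_le_add hfxy hgxy)

theorem continuous_of_mem_Flam (hφ : φ ∈ Flam lam) : Continuous φ := by
  obtain ⟨f, g, hf, hg, hφ⟩ := hφ
  rw [funext hφ]
  have hf' := hf.continuous
  have hg' := fun j => (hg j).continuous
  fun_prop

theorem zero_mem_Flam : (fun _ => 0) ∈ Flam lam :=
  ⟨fun _ => 0, fun _ _ => 0, LipschitzWith.const' 0, fun _ => LipschitzWith.const' 0, by simp⟩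

theorem integral_le_of_mem_Flam {M : ℝ} (P : Measure (EuclideanSpace ℝ (Fin d)))
    [IsProbabilityMeasure P] (hsupp : P (Metric.closedBall 0 M)ᶜ = 0) (hφ : φ ∈ Flam lam) :
    ∫ y, φ y ∂P ≤ φ 0 + (1 + Real.sqrt (∑ j : Fin d, lam j ^ 2)) * M := by
  set L := 1 + Real.sqrt (∑ j : Fin d, lam j ^ 2) with hL
  have hbound : ∀ᵐ y ∂P, ‖φ y - φ 0‖ ≤ L * M := by
    filter_upwards [compl_mem_ae_iff.mpr hsupp] with y hy
    have hy' : ‖y‖ ≤ M := by simpa using hy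
    have h := abs_sub_le_of_mem_Flam hφ y 0
    rw [sub_zero] at h
    exact h.trans (mul_le_mul_of_nonneg_left hy' (by positivity))
  have hInt : Integrable (fun y => φ y - φ 0) P :=
    Integrable.of_bound ((continuous_of_mem_Flam hφ).sub
      continuous_const).aestronglyMeasurable (L * M) hbound
  have hφint : Integrable φ P := by
    refine (hInt.add (integrable_const (φ 0))).congr (.of_forall fun y => ?_)
    simp
  have h := norm_integral_le_of_norm_le_const hbound
  rw [integral_sub hφint (integrable_const _)] at h
  simp only [integral_const, probReal_univ, one_smul, mul_one, Real.norm_eq_abs] at h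
  linarith [le_abs_self ((∫ y, φ y ∂P) - φ 0)]

theorem bddAbove_Hfun_set {M : ℝ} (hn : 0 < n) (P : Measure (EuclideanSpace ℝ (Fin d)))
    [IsProbabilityMeasure P] (hsupp : P (Metric.closedBall 0 M)ᶜ = 0)
    {x : Fin n → EuclideanSpace ℝ (Fin d)} (hx : ∀ i, x i ∈ Metric.closedBall 0 M) :
    BddAbove {r : ℝ | ∃ φ ∈ Flam lam,
      r = (∫ y, φ y ∂P) - (n : ℝ)⁻¹ * ∑ i : Fin n, φ (x i)} := by
  refine ⟨2 * ((1 + Real.sqrt (∑ j : Fin d, lam j ^ 2)) * M), ?_⟩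
  rintro r ⟨φ, hφ, rfl⟩
  have hInt := integral_le_of_mem_Flam P hsupp hφ
  set L := 1 + Real.sqrt (∑ j : Fin d, lam j ^ 2) with hL
  have hn' : (0 : ℝ) < n := Nat.cast_pos.mpr hn
  have hsum : ∑ _i : Fin n, (φ 0 - L * M) ≤ ∑ i : Fin n, φ (x i) := by
    refine Finset.sum_le_sum fun i _ => ?_
    have hxi : ‖x i‖ ≤ M := by simpa using hx i
    have h := abs_sub_le_of_mem_Flam hφ (x i) 0
    rw [sub_zero] at h
    have h' : L * ‖x i‖ ≤ L * M := mul_le_mul_of_nonneg_left hxi (by positivity)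
    linarith [neg_abs_le (φ (x i) - φ 0)]
  have havg : φ 0 - L * M ≤ (n : ℝ)⁻¹ * ∑ i : Fin n, φ (x i) := by
    rw [inv_mul_eq_div, le_div_iff₀' hn']
    rwa [Finset.sum_const, Finset.card_univ, Fintype.card_fin, nsmul_eq_mul] at hsum
  linarith

theorem Hfun_le_add {x z : Fin n → EuclideanSpace ℝ (Fin d)}
    (P : Measure (EuclideanSpace ℝ (Fin d))) (i : Fin n) (hxz : ∀ j, j ≠ i → x j = z j)
    (hz : BddAbove {r : ℝ | ∃ φ ∈ Flam lam,
      r = (∫ y, φ y ∂P) - (n : ℝ)⁻¹ * ∑ i : Fin n, φ (z i)}) :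
    Hfun lam P x ≤ Hfun lam P z +
      (n : ℝ)⁻¹ * (1 + Real.sqrt (∑ j : Fin d, lam j ^ 2)) * ‖x i - z i‖ := by
  refine csSup_le ⟨_, _, zero_mem_Flam, rfl⟩ ?_
  rintro r ⟨φ, hφ, rfl⟩
  have hle : (∫ y, φ y ∂P) - (n : ℝ)⁻¹ * ∑ i : Fin n, φ (z i) ≤ Hfun lam P z :=
    le_csSup hz ⟨φ, hφ, rfl⟩
  have hdiff : ∑ j, φ (z j) - ∑ j, φ (x j) = φ (z i) - φ (x i) := by
    rw [← Finset.sum_sub_distrib]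
    exact Finset.sum_eq_single i (fun j _ hj => by rw [hxz j hj, sub_self]) (by simp)
  have hφi : φ (z i) - φ (x i) ≤
      (1 + Real.sqrt (∑ j : Fin d, lam j ^ 2)) * ‖x i - z i‖ := by
    rw [norm_sub_rev]
    exact (le_abs_self _).trans (abs_sub_le_of_mem_Flam hφ _ _)
  have h := mul_le_mul_of_nonneg_left (hdiff.trans_le hφi) (by positivity : (0 : ℝ) ≤ (n : ℝ)⁻¹)
  rw [mul_sub, ← mul_assoc] at h
  linarith

end

/-- For `P_X` supported in `B_M`, the supremum defining `H` is
finite on `(B_M)ⁿ` (the underlying set is nonempty and bounded above), and `H`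
satisfies the bounded-differences property: changing one sample point changes `H`
by at most `n⁻¹ (1 + ‖λ‖₂) ‖x⁽ⁱ⁾ - y⁽ⁱ⁾‖₂ ≤ 2(1 + ‖λ‖₂)M/n`. -/
theorem Hfun_bounded_differences {d n : ℕ} (hn : 0 < n) (M : ℝ) (hM : 0 < M)
    (lam : Fin d → ℝ) (hlam : ∀ j, 0 ≤ lam j)
    (P : Measure (EuclideanSpace ℝ (Fin d))) [IsProbabilityMeasure P]
    (hsupp : P (Metric.closedBall 0 M)ᶜ = 0) :
    (∀ x : Fin n → EuclideanSpace ℝ (Fin d),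
      (∀ i, x i ∈ Metric.closedBall (0 : EuclideanSpace ℝ (Fin d)) M) →
      ({r : ℝ | ∃ φ ∈ Flam lam,
          r = (∫ y, φ y ∂P) - (n : ℝ)⁻¹ * ∑ i : Fin n, φ (x i)}.Nonempty ∧
        BddAbove {r : ℝ | ∃ φ ∈ Flam lam,
          r = (∫ y, φ y ∂P) - (n : ℝ)⁻¹ * ∑ i : Fin n, φ (x i)})) ∧
    (∀ (x : Fin n → EuclideanSpace ℝ (Fin d)) (i : Fin n)
        (y : EuclideanSpace ℝ (Fin d)),
      (∀ i', x i' ∈ Metric.closedBall (0 : EuclideanSpace ℝ (Fin d)) M) →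
      y ∈ Metric.closedBall (0 : EuclideanSpace ℝ (Fin d)) M →
      |Hfun lam P x - Hfun lam P (Function.update x i y)| ≤
        (n : ℝ)⁻¹ * (1 + Real.sqrt (∑ j : Fin d, lam j ^ 2)) * ‖x i - y‖ ∧
      (n : ℝ)⁻¹ * (1 + Real.sqrt (∑ j : Fin d, lam j ^ 2)) * ‖x i - y‖ ≤
        2 * (1 + Real.sqrt (∑ j : Fin d, lam j ^ 2)) * M / n) := by
  refine ⟨fun x hx => ⟨⟨_, _, zero_mem_Flam, rfl⟩, bddAbove_Hfun_set hn P hsupp hx⟩,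
    fun x i y hx hy => ⟨?_, ?_⟩⟩
  · have hxy : ∀ j, j ≠ i → Function.update x i y j = x j :=
      fun j hj => Function.update_of_ne hj _ _
    have hxy_mem : ∀ j, Function.update x i y j ∈ Metric.closedBall 0 M := by
      intro j
      rcases eq_or_ne j i with rfl | hj
      · simpa using hy
      · rw [hxy j hj]
        exact hx j
    have h₁ := Hfun_le_add P i (fun j hj => (hxy j hj).symm)
      (bddAbove_Hfun_set (lam := lam) hn P hsupp hxy_mem)
    have h₂ := Hfun_le_add P i hxy (bddAbove_Hfun_set (lam := lam) hn P hsupp hx)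
    rw [Function.update_self] at h₁ h₂
    rw [norm_sub_rev] at h₂
    rw [abs_sub_le_iff]
    constructor <;> linarith
  · have hxi : ‖x i‖ ≤ M := by simpa using hx i
    have hy' : ‖y‖ ≤ M := by simpa using hy
    have hxy : ‖x i - y‖ ≤ 2 * M := by linarith [norm_sub_le (x i) y]
    calc (n : ℝ)⁻¹ * (1 + Real.sqrt (∑ j : Fin d, lam j ^ 2)) * ‖x i - y‖
        ≤ (n : ℝ)⁻¹ * (1 + Real.sqrt (∑ j : Fin d, lam j ^ 2)) * (2 * M) := by gcongr
      _ = 2 * (1 + Real.sqrt (∑ j : Fin d, lam j ^ 2)) * M / n := by ring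
end

section
/- Let μ, ν, ρ be Borel probability measures on ℝ with finite first moments. Suppose: (i) W₁(μ,ν) ≤ ε for some ε ≥ 0; (ii) ρ admits a Lebesgue density bounded above by a constant M > 0; and (iii) |μ([t₁,t₂]) − ρ([t₁,t₂])| ≤ s for all t₁ ≤ t₂ and some s ≥ 0. Then for all a ≤ b, |ν([a,b]) − ρ([a,b])| ≤ 4√(Mε) + s. -/
open MeasureTheory Set
open scoped ENNReal

/-- The 1-Wasserstein distance between two measures, defined via the primal
(optimal transport) formulation: the infimum of `∫ ‖x - y‖ dπ` over all
couplings `π` of `μ` and `ν`. -/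
noncomputable def W1 {E : Type*} [MeasurableSpace E] [NormedAddCommGroup E]
    (μ ν : Measure E) : ℝ :=
  sInf {c : ℝ | ∃ π : Measure (E × E), IsProbabilityMeasure π ∧
    π.map Prod.fst = μ ∧ π.map Prod.snd = ν ∧ c = ∫ p, ‖p.1 - p.2‖ ∂π}

/-- A measure has a finite first moment. -/
def FiniteFirstMoment {E : Type*} [MeasurableSpace E] [NormedAddCommGroup E]
    (μ : Measure E) : Prop :=
  HasFiniteIntegral (fun x => ‖x‖) μ

/-- If `g` lands in `B` whenever `f` lands in `A` and `|f - g| < δ`, then `P(f ∈ A)` exceeds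
`P(g ∈ B)` by at most `𝔼|f - g| / δ`. -/
theorem measureReal_preimage_le_add_integral_div {Ω E : Type*} [MeasurableSpace Ω]
    [NormedAddCommGroup E] (P : Measure Ω) [IsFiniteMeasure P] {f g : Ω → E}
    (hint : Integrable (fun ω => ‖f ω - g ω‖) P) {δ : ℝ} (hδ : 0 < δ) {A B : Set E}
    (hAB : ∀ x ∈ A, ∀ y, ‖x - y‖ < δ → y ∈ B) :
    P.real (f ⁻¹' A) ≤ P.real (g ⁻¹' B) + (∫ ω, ‖f ω - g ω‖ ∂P) / δ := by
  have hmarkov := mul_meas_ge_le_integral_of_nonneg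
    (Filter.Eventually.of_forall fun ω => norm_nonneg (f ω - g ω)) hint δ
  have hsub : f ⁻¹' A ⊆ g ⁻¹' B ∪ {ω | δ ≤ ‖f ω - g ω‖} := fun ω hω => by
    by_cases h : δ ≤ ‖f ω - g ω‖
    · exact Or.inr h
    · exact Or.inl (hAB _ hω _ (not_le.mp h))
  calc P.real (f ⁻¹' A) ≤ P.real (g ⁻¹' B ∪ {ω | δ ≤ ‖f ω - g ω‖}) := measureReal_mono hsub
    _ ≤ P.real (g ⁻¹' B) + P.real {ω | δ ≤ ‖f ω - g ω‖} := measureReal_union_le _ _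
    _ ≤ P.real (g ⁻¹' B) + (∫ ω, ‖f ω - g ω‖ ∂P) / δ := by
      gcongr
      rw [le_div_iff₀ hδ, mul_comm]
      exact hmarkov

/-- A value above `W1 μ ν` strictly bounds the cost of some coupling. -/
theorem exists_coupling_integral_lt {E : Type*} [MeasurableSpace E] [NormedAddCommGroup E]
    (μ ν : Measure E) [IsProbabilityMeasure μ] [IsProbabilityMeasure ν] {c : ℝ}
    (hc : W1 μ ν < c) :
    ∃ π : Measure (E × E), IsProbabilityMeasure π ∧ π.map Prod.fst = μ ∧
      π.map Prod.snd = ν ∧ ∫ p, ‖p.1 - p.2‖ ∂π < c := by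
  obtain ⟨_, ⟨π, hπ, h1, h2, rfl⟩, hlt⟩ := exists_lt_of_csInf_lt
    (by exact ⟨_, μ.prod ν, inferInstance, by simp, by simp, rfl⟩) hc
  exact ⟨π, hπ, h1, h2, hlt⟩

/-- A coupling of two measures with finite first moments has integrable cost. -/
theorem FiniteFirstMoment.integrable_norm_sub {E : Type*} [MeasurableSpace E]
    [NormedAddCommGroup E] [BorelSpace E] [SecondCountableTopology E] {π : Measure (E × E)}
    (h1 : FiniteFirstMoment (π.map Prod.fst)) (h2 : FiniteFirstMoment (π.map Prod.snd)) :
    Integrable (fun p : E × E => ‖p.1 - p.2‖) π := by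
  have i1 : Integrable (fun x : E => x) (π.map Prod.fst) :=
    ⟨measurable_id.aestronglyMeasurable, (hasFiniteIntegral_norm_iff _).mp h1⟩
  have i2 : Integrable (fun x : E => x) (π.map Prod.snd) :=
    ⟨measurable_id.aestronglyMeasurable, (hasFiniteIntegral_norm_iff _).mp h2⟩
  exact ((i1.comp_measurable measurable_fst).sub (i2.comp_measurable measurable_snd)).norm

/-- Under a density bound `M`, a closed interval has measure at most `M` times its length. -/
theorem measureReal_Icc_le_of_density_le {ρ : Measure ℝ} {M : ℝ} (hM : 0 ≤ M)
    (hdens : ∀ A : Set ℝ, MeasurableSet A → ρ A ≤ ENNReal.ofReal M * volume A)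
    {a b : ℝ} (hab : a ≤ b) : ρ.real (Icc a b) ≤ M * (b - a) := by
  have h := hdens (Icc a b) measurableSet_Icc
  rw [Real.volume_Icc, ← ENNReal.ofReal_mul hM] at h
  exact ENNReal.toReal_le_of_le_ofReal (mul_nonneg hM (sub_nonneg.mpr hab)) h

/-- Under a density bound `M`, enlarging an interval by `δ` on both sides adds at most `2 M δ`
to its measure. -/
theorem measureReal_Icc_sub_add_le_of_density_le {ρ : Measure ℝ} [IsFiniteMeasure ρ] {M : ℝ}
    (hM : 0 ≤ M) (hdens : ∀ A : Set ℝ, MeasurableSet A → ρ A ≤ ENNReal.ofReal M * volume A)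
    (a b : ℝ) {δ : ℝ} (hδ : 0 ≤ δ) :
    ρ.real (Icc (a - δ) (b + δ)) ≤ ρ.real (Icc a b) + 2 * M * δ := by
  have hsub : Icc (a - δ) (b + δ) ⊆ (Icc a b ∪ Icc (a - δ) a) ∪ Icc b (b + δ) := by
    rintro x ⟨h1, h2⟩
    by_cases ha : x ≤ a
    · exact Or.inl (Or.inr ⟨h1, ha⟩)
    · by_cases hb : x ≤ b
      · exact Or.inl (Or.inl ⟨(not_le.mp ha).le, hb⟩)
      · exact Or.inr ⟨(not_le.mp hb).le, h2⟩
  have hmono := measureReal_mono (μ := ρ) hsub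
  have hu := measureReal_union_le (μ := ρ) (Icc a b ∪ Icc (a - δ) a) (Icc b (b + δ))
  have hu' := measureReal_union_le (μ := ρ) (Icc a b) (Icc (a - δ) a)
  have hl := measureReal_Icc_le_of_density_le hM hdens (sub_le_self a hδ)
  have hr := measureReal_Icc_le_of_density_le hM hdens (le_add_of_nonneg_right (a := b) hδ)
  linarith

/-- The comparison of interval masses at scale `δ`, from any upper bound `c` on the cost of a
coupling. -/
theorem abs_measureReal_Icc_sub_le_of_coupling {π : Measure (ℝ × ℝ)} [IsFiniteMeasure π]
    {ρ : Measure ℝ} [IsFiniteMeasure ρ]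
    (hint : Integrable (fun p : ℝ × ℝ => ‖p.1 - p.2‖) π) {c : ℝ}
    (hc : ∫ p, ‖p.1 - p.2‖ ∂π ≤ c) {M : ℝ} (hM : 0 ≤ M)
    (hdens : ∀ A : Set ℝ, MeasurableSet A → ρ A ≤ ENNReal.ofReal M * volume A)
    {s : ℝ} (hs : 0 ≤ s)
    (hclose : ∀ t₁ t₂ : ℝ, t₁ ≤ t₂ →
      |(π.map Prod.fst).real (Icc t₁ t₂) - ρ.real (Icc t₁ t₂)| ≤ s)
    {a b : ℝ} (hab : a ≤ b) {δ : ℝ} (hδ : 0 < δ) :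
    |(π.map Prod.snd).real (Icc a b) - ρ.real (Icc a b)| ≤ 2 * M * δ + c / δ + s := by
  have hcδ : (∫ p, ‖p.1 - p.2‖ ∂π) / δ ≤ c / δ := by gcongr
  have hcδ0 : 0 ≤ c / δ :=
    (div_nonneg (integral_nonneg fun _ => norm_nonneg _) hδ.le).trans hcδ
  have hfst (t₁ t₂ : ℝ) : (π.map Prod.fst).real (Icc t₁ t₂) = π.real (Prod.fst ⁻¹' Icc t₁ t₂) :=
    map_measureReal_apply measurable_fst measurableSet_Icc
  rw [map_measureReal_apply measurable_snd measurableSet_Icc, abs_sub_le_iff]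
  constructor
  · have hmove : π.real (Prod.snd ⁻¹' Icc a b) ≤ π.real (Prod.fst ⁻¹' Icc (a - δ) (b + δ)) +
        (∫ p, ‖p.1 - p.2‖ ∂π) / δ := by
      simp_rw [norm_sub_rev (Prod.fst _)] at hint ⊢
      refine measureReal_preimage_le_add_integral_div π hint hδ fun x hx y hxy => ?_
      rw [Real.norm_eq_abs, abs_lt] at hxy
      exact ⟨by linarith [hx.1], by linarith [hx.2]⟩
    have hcl := (abs_sub_le_iff.mp (hclose (a - δ) (b + δ) (by linarith))).1
    rw [hfst] at hcl
    linarith [measureReal_Icc_sub_add_le_of_density_le hM hdens a b hδ.le]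
  · rcases le_total (a + δ) (b - δ) with h | h
    · have hmove : π.real (Prod.fst ⁻¹' Icc (a + δ) (b - δ)) ≤ π.real (Prod.snd ⁻¹' Icc a b) +
          (∫ p, ‖p.1 - p.2‖ ∂π) / δ := by
        refine measureReal_preimage_le_add_integral_div π hint hδ fun x hx y hxy => ?_
        rw [Real.norm_eq_abs, abs_lt] at hxy
        exact ⟨by linarith [hx.1], by linarith [hx.2]⟩
      have hcl := (abs_sub_le_iff.mp (hclose (a + δ) (b - δ) h)).2
      rw [hfst] at hcl
      have hρ := measureReal_Icc_sub_add_le_of_density_le hM hdens (a + δ) (b - δ) hδ.le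
      rw [add_sub_cancel_right, sub_add_cancel] at hρ
      linarith
    · have hρ := measureReal_Icc_le_of_density_le hM hdens hab
      have hlen : M * (b - a) ≤ M * (2 * δ) := by gcongr; linarith
      have hnonneg : 0 ≤ π.real (Prod.snd ⁻¹' Icc a b) := measureReal_nonneg
      linarith

/-- If `W₁(μ,ν) ≤ ε`, `ρ` has a Lebesgue density bounded by `M`
(i.e. `ρ(A) ≤ M · Leb(A)` for every Borel set `A`), and `μ` and `ρ` assign masses
within `s` to every closed interval, then `ν` and `ρ` assign masses within
`4√(Mε) + s` to every closed interval. -/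
theorem interval_bound_density_wasserstein (μ ν ρ : Measure ℝ)
    [IsProbabilityMeasure μ] [IsProbabilityMeasure ν] [IsProbabilityMeasure ρ]
    (hμ : FiniteFirstMoment μ) (hν : FiniteFirstMoment ν) (hρ : FiniteFirstMoment ρ)
    (ε : ℝ) (hε : 0 ≤ ε) (hW : W1 μ ν ≤ ε)
    (M : ℝ) (hM : 0 < M)
    (hdens : ∀ A : Set ℝ, MeasurableSet A → ρ A ≤ ENNReal.ofReal M * volume A)
    (s : ℝ) (hs : 0 ≤ s)
    (hclose : ∀ t₁ t₂ : ℝ, t₁ ≤ t₂ →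
      |(μ (Set.Icc t₁ t₂)).toReal - (ρ (Set.Icc t₁ t₂)).toReal| ≤ s) :
    ∀ a b : ℝ, a ≤ b →
      |(ν (Set.Icc a b)).toReal - (ρ (Set.Icc a b)).toReal| ≤
        4 * Real.sqrt (M * ε) + s := by
  intro a b hab
  have hbound (e : ℝ) (he : ε < e) :
      |ν.real (Icc a b) - ρ.real (Icc a b)| ≤ 4 * Real.sqrt (M * e) + s := by
    have he0 : 0 < e := hε.trans_lt he
    obtain ⟨π, hπ, rfl, rfl, hcost⟩ := exists_coupling_integral_lt μ ν (hW.trans_lt he)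
    have hr : 0 < Real.sqrt (M * e) := Real.sqrt_pos.mpr (mul_pos hM he0)
    have hsq : Real.sqrt (M * e) * Real.sqrt (M * e) = M * e :=
      Real.mul_self_sqrt (mul_pos hM he0).le
    have h := abs_measureReal_Icc_sub_le_of_coupling (hμ.integrable_norm_sub hν) hcost.le hM.le
      hdens hs hclose hab (div_pos hr hM)
    have h1 : 2 * M * (Real.sqrt (M * e) / M) = 2 * Real.sqrt (M * e) := by field_simp
    have h2 : e / (Real.sqrt (M * e) / M) = Real.sqrt (M * e) := by
      rw [div_div_eq_mul_div, div_eq_iff hr.ne', hsq, mul_comm]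
    linarith
  have hcont : Continuous fun e : ℝ => 4 * Real.sqrt (M * e) + s := by fun_prop
  exact ge_of_tendsto (hcont.continuousWithinAt (s := Ioi ε) (x := ε))
    (Filter.eventually_of_mem self_mem_nhdsWithin hbound)
end
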